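/- There exists a constant c > 0 such that lim_{ℓ→∞} (ℓ² / log ℓ) · ∫₀^π P_ℓ(cos θ)⁴ sin θ dθ = c; that is, the fourth-moment integral of Legendre polynomials satisfies ∫₀^π P_ℓ(cos θ)⁴ sin θ dθ ≈ (log ℓ)/ℓ² up to a positive constant factor, as ℓ → ∞. -/

import Mathlib

open MeasureTheory Real Filter
open scoped ENNReal NNReal

noncomputable section

/-- The ℓ-th Legendre polynomial, via Rodrigues' formula
`P_ℓ(t) = (1/(2^ℓ ℓ!)) (d/dt)^ℓ (t²−1)^ℓ`. -/
def legendreP (ℓ : ℕ) (t : ℝ) : ℝ :=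
  (1 / (2 ^ ℓ * (Nat.factorial ℓ : ℝ))) * iteratedDeriv ℓ (fun s => (s ^ 2 - 1) ^ ℓ) t

/-- The Bessel function of the first kind of order zero,
`J₀(ψ) = ∑_k (−1)^k (ψ/2)^{2k} / (k!)²`. -/
def besselJ0 (ψ : ℝ) : ℝ :=
  ∑' k : ℕ, (-1 : ℝ) ^ k * (ψ / 2) ^ (2 * k) / ((Nat.factorial k : ℝ) ^ 2)

open Polynomial in
/-- The Legendre polynomials as elements of `ℝ[X]`. -/
def legendrePoly (ℓ : ℕ) : ℝ[X] :=
  C (1 / (2 ^ ℓ * (Nat.factorial ℓ : ℝ))) * derivative^[ℓ] ((X ^ 2 - 1) ^ ℓ)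

section LegendrePoly

open Polynomial

lemma Polynomial.iteratedDeriv_eval (p : ℝ[X]) (n : ℕ) :
    iteratedDeriv n (fun t => p.eval t) = fun t => (derivative^[n] p).eval t := by
  induction n with
  | zero => simp
  | succ n ih =>
    rw [iteratedDeriv_succ, ih]
    ext t
    rw [Polynomial.deriv, Function.iterate_succ_apply']

lemma legendreP_eq_eval (ℓ : ℕ) (t : ℝ) : legendreP ℓ t = (legendrePoly ℓ).eval t := by
  have h : (fun s : ℝ => (s ^ 2 - 1) ^ ℓ) = fun s => ((X ^ 2 - 1 : ℝ[X]) ^ ℓ).eval s := by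
    ext s; simp
  rw [legendreP, legendrePoly, h, Polynomial.iteratedDeriv_eval, eval_mul, eval_C]

lemma legendrePoly_zero : legendrePoly 0 = 1 := by
  simp [legendrePoly]

lemma derivative_X_sq_sub_one_pow_succ (ℓ : ℕ) :
    derivative ((X ^ 2 - 1 : ℝ[X]) ^ (ℓ + 1)) =
      C (2 * (ℓ + 1 : ℝ)) * ((X ^ 2 - 1) ^ ℓ * X) := by
  rw [derivative_pow_succ]
  simp [map_ofNat C]
  ring

lemma rodrigues_coeff_succ (ℓ : ℕ) :
    (1 / (2 ^ (ℓ + 1) * (Nat.factorial (ℓ + 1) : ℝ))) * (2 * (ℓ + 1 : ℝ)) =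
      1 / (2 ^ ℓ * (Nat.factorial ℓ : ℝ)) := by
  rw [Nat.factorial_succ]
  push_cast
  field_simp
  ring

lemma legendrePoly_succ_eq (ℓ : ℕ) :
    legendrePoly (ℓ + 1) =
      C (1 / (2 ^ ℓ * (Nat.factorial ℓ : ℝ))) * derivative^[ℓ] ((X ^ 2 - 1) ^ ℓ * X) := by
  rw [legendrePoly, Function.iterate_succ_apply, derivative_X_sq_sub_one_pow_succ,
    iterate_derivative_C_mul, ← mul_assoc, ← C_mul, rodrigues_coeff_succ]

lemma derivative_legendrePoly_succ (ℓ : ℕ) :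
    derivative (legendrePoly (ℓ + 1)) =
      X * derivative (legendrePoly ℓ) + C (ℓ + 1 : ℝ) * legendrePoly ℓ := by
  rw [legendrePoly_succ_eq, derivative_C_mul, ← Function.iterate_succ_apply' (⇑derivative),
    iterate_derivative_mul_X, legendrePoly, derivative_C_mul,
    ← Function.iterate_succ_apply' (⇑derivative)]
  simp
  ring

lemma X_sq_sub_one_mul_iterate_derivative (m : ℕ) :
    (X ^ 2 - 1) * derivative^[m + 2] ((X ^ 2 - 1 : ℝ[X]) ^ (m + 1)) =
      C ((m + 1 : ℝ) * (m + 2)) * derivative^[m] ((X ^ 2 - 1) ^ (m + 1)) := by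
  set U : ℝ[X] := (X ^ 2 - 1) ^ (m + 1) with hU
  have h : derivative U * X * X - derivative U = C (2 * (m + 1 : ℝ)) * (U * X) := by
    rw [hU, derivative_X_sq_sub_one_pow_succ]; ring
  have h2 := congrArg (derivative^[m + 1]) h
  rw [iterate_derivative_sub, iterate_derivative_C_mul, iterate_derivative_mul_X,
    iterate_derivative_mul_X, iterate_derivative_mul_X, Nat.add_sub_cancel,
    iterate_derivative_mul_X, ← Function.iterate_succ_apply, ← Function.iterate_succ_apply] at h2
  rcases m with _ | m
  · simp [map_ofNat C] at h2 ⊢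
    linear_combination h2
  · rw [Nat.add_sub_cancel, ← Function.iterate_succ_apply] at h2
    simp [map_ofNat C] at h2 ⊢
    linear_combination h2

lemma legendrePoly_succ_sub (ℓ : ℕ) :
    C (ℓ + 1 : ℝ) * (legendrePoly (ℓ + 1) - X * legendrePoly ℓ) =
      (X ^ 2 - 1) * derivative (legendrePoly ℓ) := by
  rw [legendrePoly_succ_eq, iterate_derivative_mul_X, legendrePoly, derivative_C_mul,
    ← Function.iterate_succ_apply' (⇑derivative)]
  rcases ℓ with _ | m
  · simp
  · have := X_sq_sub_one_mul_iterate_derivative m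
    simp only [Nat.succ_eq_add_one, Nat.add_sub_cancel, nsmul_eq_mul] at this ⊢
    simp [map_ofNat C] at this ⊢
    linear_combination
      (-(C (Nat.factorial (m + 1) : ℝ)⁻¹ * C ((2 : ℝ) ^ (m + 1))⁻¹)) * this

lemma legendrePoly_one : legendrePoly 1 = X := by
  have := legendrePoly_succ_sub 0
  simp [legendrePoly_zero, sub_eq_zero] at this
  exact this

lemma legendrePoly_three_term (ℓ : ℕ) :
    C (ℓ + 2 : ℝ) * legendrePoly (ℓ + 2) =
      C (2 * ℓ + 3 : ℝ) * (X * legendrePoly (ℓ + 1)) - C (ℓ + 1 : ℝ) * legendrePoly ℓ := by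
  have h1 := legendrePoly_succ_sub (ℓ + 1)
  have h2 := legendrePoly_succ_sub ℓ
  have h3 := derivative_legendrePoly_succ ℓ
  rw [h3] at h1
  simp [map_ofNat C] at h1 h2 ⊢
  linear_combination h1 + X * (-h2)

lemma legendrePoly_ode (ℓ : ℕ) :
    2 * X * derivative (legendrePoly ℓ) + (X ^ 2 - 1) * derivative (derivative (legendrePoly ℓ)) =
      C (ℓ * (ℓ + 1) : ℝ) * legendrePoly ℓ := by
  have h1 := congrArg derivative (legendrePoly_succ_sub ℓ)
  have h3 := derivative_legendrePoly_succ ℓ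
  simp only [derivative_mul, derivative_C, derivative_sub, h3] at h1
  simp at h1 ⊢
  linear_combination -h1

lemma X_sq_sub_one_mul_derivative_legendrePoly (l : ℕ) :
    C (2 * l + 3 : ℝ) * ((X ^ 2 - 1) * derivative (legendrePoly (l + 1))) =
      C ((l + 1) * (l + 2) : ℝ) * (legendrePoly (l + 2) - legendrePoly l) := by
  have h1 := legendrePoly_succ_sub (l + 1)
  have h2 := legendrePoly_three_term l
  simp [map_ofNat C] at h1 h2 ⊢
  linear_combination (-(2 * (l : ℝ[X]) + 3)) * h1 + ((l : ℝ[X]) + 2) * h2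

/-- Integration over `[-1, 1]` as a linear functional on polynomials. -/
def integralPoly : ℝ[X] →ₗ[ℝ] ℝ where
  toFun p := ∫ t in (-1 : ℝ)..1, p.eval t
  map_add' p q := by
    simp only [eval_add]
    exact intervalIntegral.integral_add (p.continuous.intervalIntegrable _ _)
      (q.continuous.intervalIntegrable _ _)
  map_smul' c p := by
    simp

lemma integralPoly_C_mul (c : ℝ) (p : ℝ[X]) :
    integralPoly (C c * p) = c * integralPoly p := by
  rw [← smul_eq_C_mul, map_smul, smul_eq_mul]

lemma integralPoly_derivative (p : ℝ[X]) :
    integralPoly (derivative p) = p.eval 1 - p.eval (-1) :=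
  intervalIntegral.integral_eq_sub_of_hasDerivAt (fun t _ => p.hasDerivAt t)
    ((derivative p).continuous.intervalIntegrable _ _)

lemma integralPoly_derivative_X_sq_sub_one_mul (p : ℝ[X]) :
    integralPoly (derivative ((X ^ 2 - 1) * p)) = 0 := by
  rw [integralPoly_derivative]
  simp

lemma integralPoly_legendrePoly_mul_of_ne {k l : ℕ} (h : k ≠ l) :
    integralPoly (legendrePoly k * legendrePoly l) = 0 := by
  have h0 := integralPoly_derivative_X_sq_sub_one_mul
    (derivative (legendrePoly k) * legendrePoly l - legendrePoly k * derivative (legendrePoly l))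
  have h1 : derivative ((X ^ 2 - 1) * (derivative (legendrePoly k) * legendrePoly l -
      legendrePoly k * derivative (legendrePoly l))) =
      C (k * (k + 1) - l * (l + 1) : ℝ) * (legendrePoly k * legendrePoly l) := by
    have hk := legendrePoly_ode k
    have hl := legendrePoly_ode l
    simp [derivative_mul] at hk hl ⊢
    linear_combination legendrePoly l * hk - legendrePoly k * hl
  rw [h1, integralPoly_C_mul] at h0
  refine (mul_eq_zero.mp h0).resolve_left fun h2 => h ?_
  have h3 : ((k : ℝ) - l) * (k + l + 1) = 0 := by linear_combination h2
  have h4 : (k : ℝ) + l + 1 ≠ 0 := by positivity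
  exact_mod_cast sub_eq_zero.mp ((mul_eq_zero.mp h3).resolve_right h4)

lemma integralPoly_one : integralPoly 1 = 2 := by
  simp [integralPoly]
  norm_num

lemma integralPoly_legendrePoly_mul_self (l : ℕ) :
    integralPoly (legendrePoly l * legendrePoly l) = 2 / (2 * l + 1) := by
  induction l with
  | zero => simp [legendrePoly_zero, integralPoly_one]
  | succ l ih =>
    have h1 : (2 * l + 3 : ℝ) * integralPoly (X * legendrePoly l * legendrePoly (l + 1)) =
        (l + 1) * integralPoly (legendrePoly l * legendrePoly l) := by
      have h := legendrePoly_three_term l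
      have h' : C (2 * l + 3 : ℝ) * (X * legendrePoly l * legendrePoly (l + 1)) =
          C (l + 2 : ℝ) * (legendrePoly (l + 2) * legendrePoly l) +
            C (l + 1 : ℝ) * (legendrePoly l * legendrePoly l) := by
        linear_combination -legendrePoly l * h
      have := congrArg integralPoly h'
      rw [map_add integralPoly, integralPoly_C_mul, integralPoly_C_mul, integralPoly_C_mul,
        integralPoly_legendrePoly_mul_of_ne (by omega)] at this
      linarith
    have h2 : (2 * l + 1 : ℝ) * integralPoly (X * legendrePoly l * legendrePoly (l + 1)) =
        (l + 1) * integralPoly (legendrePoly (l + 1) * legendrePoly (l + 1)) := by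
      rcases l with _ | l
      · simp [legendrePoly_zero, legendrePoly_one]
      have h := legendrePoly_three_term l
      have h' : C (2 * l + 3 : ℝ) * (X * legendrePoly (l + 1) * legendrePoly (l + 2)) =
          C (l + 2 : ℝ) * (legendrePoly (l + 2) * legendrePoly (l + 2)) +
            C (l + 1 : ℝ) * (legendrePoly l * legendrePoly (l + 2)) := by
        linear_combination -legendrePoly (l + 2) * h
      have := congrArg integralPoly h'
      rw [map_add integralPoly, integralPoly_C_mul, integralPoly_C_mul, integralPoly_C_mul,
        integralPoly_legendrePoly_mul_of_ne (show l ≠ l + 2 by omega)] at this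
      push_cast
      linear_combination this
    rw [ih] at h1
    push_cast
    have e : (2 * l + 1 : ℝ) ≠ 0 := by positivity
    have e' : (2 * (l + 1) + 1 : ℝ) ≠ 0 := by positivity
    have e'' : (l + 1 : ℝ) ≠ 0 := by positivity
    rw [eq_div_iff e']
    apply mul_left_cancel₀ e''
    field_simp at h1
    linear_combination -(2 * (l : ℝ) + 3) * h2 + h1

lemma integralPoly_sq_legendrePoly_mul (n : ℕ) {v : ℝ[X]} {μ : ℝ}
    (hv : 2 * X * derivative v + (X ^ 2 - 1) * derivative (derivative v) = C μ * v) :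
    integralPoly (legendrePoly n ^ 2 *
      (C (μ / 2) * (2 * X * v + (X ^ 2 - 1) * derivative v) -
        C (2 * (n * (n + 1)) : ℝ) * ((X ^ 2 - 1) * derivative v + X * v))) = 0 := by
  have hu := legendrePoly_ode n
  set u := legendrePoly n
  rw [← integralPoly_derivative_X_sq_sub_one_mul
    (((X ^ 2 - 1) * derivative u ^ 2 + C (n * (n + 1) : ℝ) * u ^ 2) * v
      - (X ^ 2 - 1) * u * derivative u * derivative v
      - C (2 * (n * (n + 1)) : ℝ) * u ^ 2 * v + C (μ / 2) * u ^ 2 * v)]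
  congr 1
  have hμ : C μ = 2 * C (μ / 2) := by
    rw [← map_ofNat C, ← C_mul]; congr 1; ring
  rw [hμ] at hv
  simp only [derivative_mul, derivative_add, derivative_sub, derivative_pow, derivative_C,
    derivative_X, derivative_one, C_mul, map_ofNat C] at hu hv ⊢
  simp [map_ofNat C]
  simp at hu
  linear_combination (-2 * (X ^ 2 - 1) * derivative u * v + (X ^ 2 - 1) * u * derivative v) * hu
    + ((X ^ 2 - 1) * u * derivative u) * hv

/-- Two-term recurrence for the Legendre moments of the square of a Legendre polynomial. -/
lemma moment_recurrence (n l : ℕ) :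
    (l + 2 : ℝ) ^ 2 * ((2 * n + 1) ^ 2 - (l + 2) ^ 2) *
        integralPoly (legendrePoly n ^ 2 * legendrePoly (l + 2)) =
      (l + 1) ^ 2 * ((2 * n + 1) ^ 2 - (l + 1) ^ 2) *
        integralPoly (legendrePoly n ^ 2 * legendrePoly l) := by
  have h := integralPoly_sq_legendrePoly_mul n (legendrePoly_ode (l + 1))
  have h1 := X_sq_sub_one_mul_derivative_legendrePoly l
  have h2 := legendrePoly_three_term l
  set μ : ℝ := ((l + 1 : ℕ) : ℝ) * (((l + 1 : ℕ) : ℝ) + 1) with hμ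
  have h3 : C (2 * l + 3 : ℝ) * (legendrePoly n ^ 2 *
      (C (μ / 2) * (2 * X * legendrePoly (l + 1) +
          (X ^ 2 - 1) * derivative (legendrePoly (l + 1))) -
        C (2 * (n * (n + 1)) : ℝ) * ((X ^ 2 - 1) * derivative (legendrePoly (l + 1)) +
          X * legendrePoly (l + 1)))) =
      C (μ / 2 * (2 * (l + 2) + (l + 1) * (l + 2)) -
          2 * (n * (n + 1)) * ((l + 1) * (l + 2) + (l + 2))) *
        (legendrePoly n ^ 2 * legendrePoly (l + 2)) +
      C (μ / 2 * (2 * (l + 1) - (l + 1) * (l + 2)) -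
          2 * (n * (n + 1)) * (-((l + 1) * (l + 2)) + (l + 1))) *
        (legendrePoly n ^ 2 * legendrePoly l) := by
    simp only [C_mul, C_add, C_sub, C_neg] at h1 h2 ⊢
    simp only [map_ofNat C] at h1 h2 ⊢
    linear_combination (legendrePoly n ^ 2 * (C (μ / 2) - 2 * (C (n : ℝ) * (C (n : ℝ) + C 1)))) * h1
      - (legendrePoly n ^ 2 * (2 * C (μ / 2) - 2 * (C (n : ℝ) * (C (n : ℝ) + C 1)))) * h2
  have h4 := congrArg integralPoly h3
  rw [map_add integralPoly, integralPoly_C_mul, integralPoly_C_mul, integralPoly_C_mul, h, hμ] at h4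
  push_cast at h4
  linear_combination 2 * h4

lemma moment_one (n : ℕ) : integralPoly (legendrePoly n ^ 2 * legendrePoly 1) = 0 := by
  rcases Nat.eq_zero_or_pos n with rfl | hn
  · rw [legendrePoly_zero, one_pow, ← legendrePoly_zero]
    exact integralPoly_legendrePoly_mul_of_ne (by omega)
  · have h := integralPoly_sq_legendrePoly_mul n (v := 1) (μ := 0) (by simp)
    have h' : legendrePoly n ^ 2 *
      (C ((0 : ℝ) / 2) * (2 * X * 1 + (X ^ 2 - 1) * derivative 1) -
        C (2 * (n * (n + 1)) : ℝ) * ((X ^ 2 - 1) * derivative 1 + X * 1)) =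
        C (-(2 * (n * (n + 1))) : ℝ) * (legendrePoly n ^ 2 * legendrePoly 1) := by
      rw [legendrePoly_one]
      simp
      ring
    rw [h', integralPoly_C_mul] at h
    refine (mul_eq_zero.mp h).resolve_left ?_
    have : (0 : ℝ) < n := by exact_mod_cast hn
    apply ne_of_lt
    have : (0 : ℝ) < n * (n + 1) := by positivity
    linarith

lemma moment_odd {n i : ℕ} (hi : i < n) :
    integralPoly (legendrePoly n ^ 2 * legendrePoly (2 * i + 1)) = 0 := by
  induction i with
  | zero => exact moment_one n
  | succ i ih =>
    have hr := moment_recurrence n (2 * i + 1)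
    rw [ih (by omega), mul_zero] at hr
    refine (mul_eq_zero.mp hr).resolve_left ?_
    have h' : ((i : ℝ) + 1) < n := by exact_mod_cast hi
    have hi : (0 : ℝ) ≤ i := i.cast_nonneg
    push_cast
    refine mul_ne_zero (by positivity) (ne_of_gt ?_)
    nlinarith

/-- The squares of the even Legendre moments of `P_n ^ 2`, in terms of Wallis products. -/
lemma moment_even_sq {n k : ℕ} (hk : k ≤ n) :
    integralPoly (legendrePoly n ^ 2 * legendrePoly (2 * k)) ^ 2 =
      4 * Wallis.W (n + k) / ((2 * k + 1) ^ 2 * Wallis.W k ^ 2 * (2 * n - 2 * k + 1) *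
        (2 * n + 2 * k + 1) * Wallis.W (n - k)) := by
  induction k with
  | zero =>
    have := (Wallis.W_pos n).ne'
    have h0 : Wallis.W 0 = 1 := by simp [Wallis.W]
    simp only [mul_zero, legendrePoly_zero, mul_one, sq (legendrePoly n),
      integralPoly_legendrePoly_mul_self, h0, Nat.sub_zero, Nat.add_zero]
    have e : (2 * n + 1 : ℝ) ≠ 0 := by positivity
    simp
    field_simp
    norm_num
  | succ k ih =>
    have ih := ih (by omega)
    obtain ⟨m, rfl⟩ := Nat.exists_eq_add_of_le hk
    have hr := moment_recurrence (k + 1 + m) (2 * k)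
    rw [show 2 * (k + 1) = 2 * k + 2 by ring]
    set A := integralPoly (legendrePoly (k + 1 + m) ^ 2 * legendrePoly (2 * k))
    set B := integralPoly (legendrePoly (k + 1 + m) ^ 2 * legendrePoly (2 * k + 2))
    rw [show k + 1 + m - k = m + 1 by omega, Wallis.W_succ] at ih
    rw [show k + 1 + m - (k + 1) = m by omega,
      show k + 1 + m + (k + 1) = k + 1 + m + k + 1 by ring, Wallis.W_succ k, Wallis.W_succ (_ + k)]
    have hB : B = A * ((2 * k + 1) ^ 2 * (2 * m + 2) * (4 * k + 2 * m + 4)) /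
        ((2 * k + 2) ^ 2 * (2 * m + 1) * (4 * k + 2 * m + 5)) := by
      rw [eq_div_iff (by positivity)]
      push_cast at hr
      linear_combination hr
    have h1 := (Wallis.W_pos k).ne'
    have h2 := (Wallis.W_pos m).ne'
    have h3 := (Wallis.W_pos (k + 1 + m + k)).ne'
    rw [hB, div_pow, mul_pow, ih]
    push_cast
    have e1 : (2 * (k + 1 + m) - 2 * k + 1 : ℝ) = 2 * m + 3 := by ring
    have e2 : (2 * (k + 1 + m) - 2 * (k + 1) + 1 : ℝ) = 2 * m + 1 := by ring
    have e3 : (2 * (k + 1 + m) + 2 * k + 1 : ℝ) = 4 * k + 2 * m + 3 := by ring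
    have e4 : (2 * (k + 1 + m) + 2 * (k + 1) + 1 : ℝ) = 4 * k + 2 * m + 5 := by ring
    have e5 : (2 * (k + 1 + m + k) + 1 : ℝ) = 4 * k + 2 * m + 3 := by ring
    have e6 : (2 * (k + 1 + m + k) + 2 : ℝ) = 4 * k + 2 * m + 4 := by ring
    have e7 : (2 * (k + 1 + m + k) + 3 : ℝ) = 4 * k + 2 * m + 5 := by ring
    rw [e1, e2, e3, e4, e5, e6, e7]
    field_simp
    ring

/-- The span of the Legendre polynomials of index less than `N`. -/
def legendreSpan (N : ℕ) : Submodule ℝ ℝ[X] :=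
  Submodule.span ℝ (legendrePoly '' (Finset.range N : Set ℕ))

lemma legendrePoly_mem_legendreSpan {k N : ℕ} (h : k < N) : legendrePoly k ∈ legendreSpan N :=
  Submodule.subset_span ⟨k, by simpa using h, rfl⟩

lemma legendreSpan_mono {M N : ℕ} (h : M ≤ N) : legendreSpan M ≤ legendreSpan N :=
  Submodule.span_mono (Set.image_mono (by
    intro k hk
    simp at hk ⊢
    omega))

lemma X_mul_legendrePoly_mem (k : ℕ) : X * legendrePoly k ∈ legendreSpan (k + 2) := by
  rcases k with _ | k
  · rw [legendrePoly_zero, mul_one, ← legendrePoly_one]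
    exact legendrePoly_mem_legendreSpan (by omega)
  · have h : X * legendrePoly (k + 1) = (1 / (2 * k + 3) : ℝ) •
        ((k + 2 : ℝ) • legendrePoly (k + 2) + (k + 1 : ℝ) • legendrePoly k) := by
      rw [eq_comm, one_div, inv_smul_eq_iff₀ (by positivity)]
      simp only [smul_eq_C_mul]
      linear_combination legendrePoly_three_term k
    rw [h]
    exact Submodule.smul_mem _ _ (Submodule.add_mem _
      (Submodule.smul_mem _ _ (legendrePoly_mem_legendreSpan (by omega)))
      (Submodule.smul_mem _ _ (legendrePoly_mem_legendreSpan (by omega))))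

lemma X_mul_mem_legendreSpan {N : ℕ} {q : ℝ[X]} (hq : q ∈ legendreSpan N) :
    X * q ∈ legendreSpan (N + 1) := by
  induction hq using Submodule.span_induction with
  | mem x h =>
    obtain ⟨k, hk, rfl⟩ := h
    have hk : k < N := by simpa using hk
    exact legendreSpan_mono (by omega) (X_mul_legendrePoly_mem k)
  | zero => simp
  | add x y _ _ hx hy => rw [mul_add]; exact Submodule.add_mem _ hx hy
  | smul a x _ hx => rw [mul_smul_comm]; exact Submodule.smul_mem _ _ hx

lemma legendrePoly_mul_mem_legendreSpan (m n : ℕ) :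
    legendrePoly m * legendrePoly n ∈ legendreSpan (m + n + 1) := by
  induction m using Nat.twoStepInduction with
  | zero =>
    rw [legendrePoly_zero, one_mul]
    exact legendrePoly_mem_legendreSpan (by omega)
  | one =>
    rw [legendrePoly_one]
    exact legendreSpan_mono (by omega) (X_mul_legendrePoly_mem n)
  | more k h0 h1 =>
    have h : legendrePoly (k + 2) * legendrePoly n = (1 / (k + 2) : ℝ) •
        ((2 * k + 3 : ℝ) • (X * (legendrePoly (k + 1) * legendrePoly n)) -
          (k + 1 : ℝ) • (legendrePoly k * legendrePoly n)) := by
      rw [eq_comm, one_div, inv_smul_eq_iff₀ (by positivity)]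
      simp only [smul_eq_C_mul]
      linear_combination -legendrePoly n * legendrePoly_three_term k
    rw [h]
    exact Submodule.smul_mem _ _ (Submodule.sub_mem _
      (Submodule.smul_mem _ _ (legendreSpan_mono (by omega) (X_mul_mem_legendreSpan h1)))
      (Submodule.smul_mem _ _ (legendreSpan_mono (by omega) h0)))

/-- Parseval's identity for polynomials in the span of finitely many Legendre polynomials. -/
lemma integralPoly_mul_self_of_mem_legendreSpan {N : ℕ} {q : ℝ[X]} (hq : q ∈ legendreSpan N) :
    integralPoly (q * q) =
      ∑ k ∈ Finset.range N, (2 * k + 1 : ℝ) / 2 * integralPoly (q * legendrePoly k) ^ 2 := by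
  obtain ⟨c, hc⟩ := Submodule.mem_span_image_finset_iff_exists_fun' ℝ |>.mp hq
  have h1 : ∀ m ∈ Finset.range N, integralPoly (q * legendrePoly m) = c m * (2 / (2 * m + 1)) := by
    intro m hm
    rw [← hc, Finset.sum_mul, map_sum, Finset.sum_eq_single_of_mem m hm]
    · rw [smul_mul_assoc, map_smul, smul_eq_mul, integralPoly_legendrePoly_mul_self]
    · intro k _ hk
      rw [smul_mul_assoc, map_smul, integralPoly_legendrePoly_mul_of_ne hk, smul_zero]
  have h2 : integralPoly (q * q) =
      ∑ k ∈ Finset.range N, c k * integralPoly (q * legendrePoly k) := by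
    nth_rw 2 [← hc]
    rw [Finset.mul_sum, map_sum]
    exact Finset.sum_congr rfl fun k _ => by rw [mul_smul_comm, map_smul, smul_eq_mul]
  rw [h2]
  refine Finset.sum_congr rfl fun k hk => ?_
  rw [h1 k hk]
  have : (2 * k + 1 : ℝ) ≠ 0 := by positivity
  field_simp

lemma sum_range_two_mul_add_one_of_odd_eq_zero {f : ℕ → ℝ} {n : ℕ}
    (hf : ∀ i < n, f (2 * i + 1) = 0) :
    ∑ k ∈ Finset.range (2 * n + 1), f k = ∑ k ∈ Finset.range (n + 1), f (2 * k) := by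
  induction n with
  | zero => simp
  | succ n ih =>
    rw [show 2 * (n + 1) + 1 = 2 * n + 1 + 1 + 1 by ring, Finset.sum_range_succ,
      Finset.sum_range_succ, ih fun i hi => hf i (by omega), hf n (by omega),
      Finset.sum_range_succ _ (n + 1), show 2 * (n + 1) = 2 * n + 1 + 1 by ring, add_zero]

/-- The fourth moment of a Legendre polynomial as a finite sum. -/
lemma integral_legendreP_pow_four (n : ℕ) :
    ∫ θ in (0 : ℝ)..π, (legendreP n (Real.cos θ)) ^ 4 * Real.sin θ =
      ∑ k ∈ Finset.range (n + 1), (4 * k + 1 : ℝ) / 2 *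
        (4 * Wallis.W (n + k) / ((2 * k + 1) ^ 2 * Wallis.W k ^ 2 * (2 * n - 2 * k + 1) *
          (2 * n + 2 * k + 1) * Wallis.W (n - k))) := by
  have h1 : ∫ θ in (0 : ℝ)..π, (legendreP n (Real.cos θ)) ^ 4 * Real.sin θ =
      integralPoly (legendrePoly n ^ 2 * legendrePoly n ^ 2) := by
    have h := intervalIntegral.integral_comp_mul_deriv (a := 0) (b := π) (f := Real.cos)
      (f' := fun θ => -Real.sin θ) (g := fun t => (legendrePoly n ^ 2 * legendrePoly n ^ 2).eval t)
      (fun θ _ => Real.hasDerivAt_cos θ) (by fun_prop) (Polynomial.continuous _)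
    rw [Real.cos_zero, Real.cos_pi, intervalIntegral.integral_symm (-1) 1] at h
    have h2 : integralPoly (legendrePoly n ^ 2 * legendrePoly n ^ 2) =
      ∫ t in (-1 : ℝ)..1, (legendrePoly n ^ 2 * legendrePoly n ^ 2).eval t := rfl
    rw [h2, ← neg_inj, ← h, ← intervalIntegral.integral_neg]
    congr 1
    ext θ
    simp only [legendreP_eq_eval, Function.comp_apply, eval_mul, eval_pow]
    ring
  have hmem : legendrePoly n ^ 2 ∈ legendreSpan (2 * n + 1) := by
    rw [sq, two_mul]
    exact legendrePoly_mul_mem_legendreSpan n n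
  rw [h1, integralPoly_mul_self_of_mem_legendreSpan hmem, sum_range_two_mul_add_one_of_odd_eq_zero]
  · refine Finset.sum_congr rfl fun k hk => ?_
    rw [moment_even_sq (by simpa [Nat.lt_succ_iff] using hk)]
    push_cast
    ring
  · intro i hi
    rw [moment_odd hi]
    ring

end LegendrePoly

section Asymptotics

open Topology

lemma sum_range_ite_lt_le {K N : ℕ} {b : ℝ} (hb : 0 ≤ b) :
    ∑ k ∈ Finset.range N, (if k < K then b else 0) ≤ K * b := by
  rw [← Finset.sum_filter, Finset.sum_const, nsmul_eq_mul]
  gcongr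
  calc ((Finset.range N).filter (· < K)).card ≤ (Finset.range K).card :=
        Finset.card_le_card fun k hk => by simp at hk ⊢; omega
    _ = K := Finset.card_range K

/-- If the weights `ω k m` are bounded and tend to `L` as `k, m → ∞`, while no single term
`h k (n - k)` contributes to the limit of `r n * ∑ k ≤ n, h k (n - k)`, then inserting the weights
multiplies the limit by `L`. -/
lemma tendsto_weighted_antidiagonal_sum {ω h : ℕ → ℕ → ℝ} {r s : ℕ → ℝ} {L B c : ℝ}
    (hω : Tendsto (fun p : ℕ × ℕ => ω p.1 p.2) atTop (𝓝 L))
    (hB : ∀ k m, |ω k m - L| ≤ B) (h0 : ∀ k m, 0 ≤ h k m) (hr : ∀ n, 0 ≤ r n)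
    (hs : ∀ k m, h k m ≤ s (k + m)) (hrs : Tendsto (fun n => r n * s n) atTop (𝓝 0))
    (hc : Tendsto (fun n => r n * ∑ k ∈ Finset.range (n + 1), h k (n - k)) atTop (𝓝 c)) :
    Tendsto (fun n => r n * ∑ k ∈ Finset.range (n + 1), ω k (n - k) * h k (n - k)) atTop
      (𝓝 (L * c)) := by
  have hB0 : 0 ≤ B := (abs_nonneg _).trans (hB 0 0)
  have hs0 : ∀ n, 0 ≤ s n := fun n => (h0 0 n).trans ((hs 0 n).trans_eq (by rw [zero_add]))
  have key : Tendsto (fun n => r n * ∑ k ∈ Finset.range (n + 1), (ω k (n - k) - L) * h k (n - k))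
      atTop (𝓝 0) := by
    rw [Metric.tendsto_atTop']
    intro ε hε
    have hδ : 0 < ε / (2 * (|c| + 1)) := by positivity
    obtain ⟨⟨a, b⟩, hab⟩ := eventually_atTop.mp
      ((Metric.tendsto_nhds.mp hω) _ hδ)
    set δ := ε / (2 * (|c| + 1)) with hδ_def
    set K := max a b
    have e1 : ∀ᶠ n in atTop, r n * ∑ k ∈ Finset.range (n + 1), h k (n - k) < |c| + 1 :=
      hc.eventually_lt_const ((le_abs_self c).trans_lt (lt_add_one _))
    have e2 : ∀ᶠ n in atTop, 2 * K * B * (r n * s n) < ε / 2 := by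
      have := hrs.const_mul (2 * K * B)
      rw [mul_zero] at this
      exact this.eventually_lt_const (by positivity)
    obtain ⟨N, hN⟩ := eventually_atTop.mp (e1.and e2)
    refine ⟨N, fun n hn => ?_⟩
    obtain ⟨h1, h2⟩ := hN n hn.le
    have hterm : ∀ k ∈ Finset.range (n + 1), |(ω k (n - k) - L) * h k (n - k)| ≤
        δ * h k (n - k) + ((if k < K then B * s n else 0) +
          (if n + 1 - 1 - k < K then B * s n else 0)) := by
      intro k hk
      have hkn : k + (n - k) = n := by simp at hk; omega
      have hBs : 0 ≤ B * s n := mul_nonneg hB0 (hs0 n)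
      have hδh : 0 ≤ δ * h k (n - k) := mul_nonneg hδ.le (h0 _ _)
      have hle : |ω k (n - k) - L| * h k (n - k) ≤ B * s n := by
        have := hs k (n - k)
        rw [hkn] at this
        exact mul_le_mul (hB _ _) this (h0 _ _) hB0
      rw [abs_mul, abs_of_nonneg (h0 _ _), Nat.add_sub_cancel]
      by_cases h3 : k < K
      · rw [if_pos h3]
        split_ifs <;> linarith
      · by_cases h4 : n - k < K
        · rw [if_neg h3, if_pos h4]
          linarith
        · rw [if_neg h3, if_neg h4, add_zero, add_zero]
          have := hab (k, n - k) ⟨by simp; omega, by simp; omega⟩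
          rw [Real.dist_eq] at this
          exact mul_le_mul_of_nonneg_right this.le (h0 _ _)
    have hsum : |∑ k ∈ Finset.range (n + 1), (ω k (n - k) - L) * h k (n - k)| ≤
        δ * ∑ k ∈ Finset.range (n + 1), h k (n - k) + 2 * K * (B * s n) := by
      refine (Finset.abs_sum_le_sum_abs _ _).trans ((Finset.sum_le_sum hterm).trans ?_)
      rw [Finset.sum_add_distrib, Finset.sum_add_distrib, ← Finset.mul_sum,
        Finset.sum_range_reflect (fun k => if k < K then B * s n else 0)]
      have := sum_range_ite_lt_le (K := K) (N := n + 1) (mul_nonneg hB0 (hs0 n))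
      linarith
    rw [Real.dist_eq, sub_zero, abs_mul, abs_of_nonneg (hr n)]
    calc _ ≤ r n * (δ * ∑ k ∈ Finset.range (n + 1), h k (n - k) + 2 * K * (B * s n)) :=
          mul_le_mul_of_nonneg_left hsum (hr n)
      _ = δ * (r n * ∑ k ∈ Finset.range (n + 1), h k (n - k)) + 2 * K * B * (r n * s n) := by ring
      _ < δ * (|c| + 1) + ε / 2 := add_lt_add_of_le_of_lt
          (mul_le_mul_of_nonneg_left h1.le hδ.le) h2
      _ = ε := by rw [hδ_def]; field_simp; ring
  have := key.add (hc.const_mul L)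
  rw [zero_add] at this
  refine this.congr fun n => ?_
  simp only [sub_mul, Finset.sum_sub_distrib, ← Finset.mul_sum]
  ring

lemma tendsto_natCast_log_atTop : Tendsto (fun n : ℕ => Real.log n) atTop atTop :=
  Real.tendsto_log_atTop.comp tendsto_natCast_atTop_atTop

lemma sum_odd_inv_eq_harmonic (n : ℕ) :
    ∑ k ∈ Finset.range (n + 1), 1 / (2 * k + 1 : ℝ) =
      (harmonic (2 * (n + 1)) : ℝ) - (harmonic (n + 1) : ℝ) / 2 := by
  induction n with
  | zero => norm_num [harmonic, Finset.sum_range_succ]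
  | succ n ih =>
    rw [Finset.sum_range_succ, ih, show 2 * (n + 1 + 1) = 2 * (n + 1) + 1 + 1 by ring,
      harmonic_succ (2 * (n + 1) + 1), harmonic_succ (2 * (n + 1)), harmonic_succ (n + 1)]
    push_cast
    field_simp
    ring

lemma tendsto_sum_odd_inv_div_log :
    Tendsto (fun n : ℕ => (∑ k ∈ Finset.range (n + 1), 1 / (2 * k + 1 : ℝ)) / Real.log n) atTop
      (𝓝 (1 / 2)) := by
  have t1 : Tendsto (fun n : ℕ => n + 1) atTop atTop := tendsto_add_atTop_nat 1
  have t2 : Tendsto (fun n : ℕ => 2 * (n + 1)) atTop atTop :=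
    tendsto_atTop_mono (fun n => by omega) t1
  have hA := tendsto_harmonic_sub_log.comp t1
  have hB := tendsto_harmonic_sub_log.comp t2
  have hC : Tendsto (fun n : ℕ => Real.log (n / (n + 1))) atTop (𝓝 0) := by
    have := (Real.continuousAt_log one_ne_zero).tendsto.comp
      (tendsto_natCast_div_add_atTop (1 : ℝ))
    rwa [Real.log_one] at this
  have hD := (((hB.sub (hA.div_const 2)).add_const (Real.log 2)).sub
    (hC.div_const 2)).div_atTop tendsto_natCast_log_atTop
  have hE := hD.add_const (1 / 2 : ℝ)
  rw [zero_add] at hE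
  refine hE.congr' ?_
  filter_upwards [eventually_ge_atTop 2] with n hn
  have hn1 : (1 : ℝ) < n := by exact_mod_cast hn
  have hlog : Real.log n ≠ 0 := (Real.log_pos hn1).ne'
  rw [sum_odd_inv_eq_harmonic, Real.log_div (by positivity) (by positivity)]
  simp only [Function.comp_apply]
  push_cast
  rw [Real.log_mul (by norm_num) (by positivity)]
  field_simp
  ring

lemma sum_antidiagonal_eq_partial_fractions {n : ℕ} (hn : 0 < n) :
    ∑ k ∈ Finset.range (n + 1),
        4 / ((2 * k + 1 : ℝ) * (2 * (n - k : ℕ) + 1) * (2 * (2 * k + (n - k : ℕ)) + 1)) =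
      4 * ((1 / ((2 * n + 2) * (2 * n)) + 1 / ((2 * n + 2) * (4 * n + 2))) *
          ∑ k ∈ Finset.range (n + 1), 1 / (2 * k + 1 : ℝ) -
        1 / (2 * n * (4 * n + 2)) * ∑ k ∈ Finset.range (n + 1), 1 / (2 * (n + k) + 1 : ℝ)) := by
  have hterm : ∀ k ∈ Finset.range (n + 1),
      4 / ((2 * k + 1 : ℝ) * (2 * (n - k : ℕ) + 1) * (2 * (2 * k + (n - k : ℕ)) + 1)) =
      4 * (1 / ((2 * n + 2) * (2 * n)) * (1 / (2 * k + 1 : ℝ)) +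
        1 / ((2 * n + 2) * (4 * n + 2)) * (1 / (2 * ((n + 1 - 1 - k : ℕ) : ℝ) + 1)) -
        1 / (2 * n * (4 * n + 2)) * (1 / (2 * (n + k) + 1 : ℝ))) := by
    intro k hk
    obtain ⟨m, rfl⟩ := Nat.exists_eq_add_of_le (show k ≤ n by simp at hk; omega)
    have e : (k + m : ℝ) ≠ 0 := by exact_mod_cast hn.ne'
    rw [Nat.add_sub_cancel, Nat.add_sub_cancel_left]
    push_cast
    have e1 : (2 * (2 * k + m) + 1 : ℝ) ≠ 0 := by positivity
    have e2 : (2 * (k + m + k) + 1 : ℝ) ≠ 0 := by positivity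
    field_simp
    ring
  rw [Finset.sum_congr rfl hterm, ← Finset.mul_sum, Finset.sum_sub_distrib,
    Finset.sum_add_distrib, ← Finset.mul_sum, ← Finset.mul_sum, ← Finset.mul_sum,
    Finset.sum_range_reflect (fun k => 1 / (2 * (k : ℝ) + 1))]
  ring

lemma sum_upper_inv_mem_Icc (n : ℕ) :
    ∑ k ∈ Finset.range (n + 1), 1 / (2 * (n + k) + 1 : ℝ) ∈ Set.Icc (0 : ℝ) 1 := by
  refine ⟨Finset.sum_nonneg fun k _ => by positivity, ?_⟩
  calc _ ≤ ∑ k ∈ Finset.range (n + 1), 1 / (n + 1 : ℝ) := by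
        refine Finset.sum_le_sum fun k _ => ?_
        refine one_div_le_one_div_of_le (by positivity) ?_
        have : (0 : ℝ) ≤ k := k.cast_nonneg
        have : (0 : ℝ) ≤ n := n.cast_nonneg
        linarith
    _ = 1 := by
        simp
        field_simp

lemma tendsto_sum_antidiagonal :
    Tendsto (fun n : ℕ => (n : ℝ) ^ 2 / Real.log n * ∑ k ∈ Finset.range (n + 1),
        4 / ((2 * k + 1 : ℝ) * (2 * (n - k : ℕ) + 1) * (2 * (2 * k + (n - k : ℕ)) + 1)))
      atTop (𝓝 (3 / 4)) := by
  have hO := tendsto_sum_odd_inv_div_log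
  have h1 := tendsto_natCast_div_add_atTop (1 : ℝ)
  have h2 := tendsto_natCast_div_add_atTop (1 / 2 : ℝ)
  have hE : Tendsto (fun n : ℕ => (∑ k ∈ Finset.range (n + 1), 1 / (2 * (n + k) + 1 : ℝ)) /
      Real.log n) atTop (𝓝 0) := by
    refine squeeze_zero' ?_ ?_ (tendsto_const_nhds (x := (1 : ℝ)).div_atTop
      tendsto_natCast_log_atTop)
    · exact Eventually.of_forall fun n =>
        div_nonneg (sum_upper_inv_mem_Icc n).1 (Real.log_natCast_nonneg n)
    · exact Eventually.of_forall fun n =>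
        div_le_div_of_nonneg_right (sum_upper_inv_mem_Icc n).2 (Real.log_natCast_nonneg n)
  have h := ((hO.mul h1).add (((hO.mul h1).mul h2).const_mul (1 / 2))).sub
    ((hE.mul h2).const_mul (1 / 2))
  have e : (1 / 2 * 1 + 1 / 2 * (1 / 2 * 1 * 1) - 1 / 2 * (0 * 1) : ℝ) = 3 / 4 := by norm_num
  rw [e] at h
  refine h.congr' ?_
  filter_upwards [eventually_ge_atTop 2] with n hn
  have hn1 : (1 : ℝ) < n := by exact_mod_cast hn
  have hlog : Real.log n ≠ 0 := (Real.log_pos hn1).ne'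
  rw [sum_antidiagonal_eq_partial_fractions (by omega)]
  have e1 : (n : ℝ) ≠ 0 := by positivity
  have e2 : (n : ℝ) + 1 / 2 ≠ 0 := by positivity
  have e3 : (2 * n + 1 : ℝ) ≠ 0 := by positivity
  have e4 : (4 * n + 2 : ℝ) = 4 * (n + 1 / 2) := by ring
  have e5 : (2 * n + 2 : ℝ) = 2 * (n + 1) := by ring
  rw [e4, e5]
  generalize (n : ℝ) + 1 / 2 = y at *
  field_simp
  ring

lemma one_le_wallis (k : ℕ) : 1 ≤ Wallis.W k := by
  induction k with
  | zero => simp [Wallis.W]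
  | succ k ih =>
    rw [Wallis.W_succ]
    refine one_le_mul_of_one_le_of_one_le ih ?_
    rw [div_mul_div_comm, one_le_div (by positivity)]
    nlinarith

/-- The ratio of the terms in the fourth-moment sum to their elementary main part. -/
def wallisWeight (k m : ℕ) : ℝ :=
  Wallis.W (2 * k + m) / (Wallis.W k ^ 2 * Wallis.W m) * (1 - 1 / (4 * k + 2))

lemma tendsto_wallisWeight :
    Tendsto (fun p : ℕ × ℕ => wallisWeight p.1 p.2) atTop (𝓝 (4 / π ^ 2)) := by
  have hW := Wallis.tendsto_W_nhds_pi_div_two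
  have t1 : Tendsto (fun p : ℕ × ℕ => p.1) atTop atTop := by
    rw [← prod_atTop_atTop_eq]; exact tendsto_fst
  have t2 : Tendsto (fun p : ℕ × ℕ => p.2) atTop atTop := by
    rw [← prod_atTop_atTop_eq]; exact tendsto_snd
  have t3 : Tendsto (fun p : ℕ × ℕ => 2 * p.1 + p.2) atTop atTop :=
    tendsto_atTop_mono (fun p => by omega) t2
  have t4 : Tendsto (fun p : ℕ × ℕ => (4 * (p.1 : ℝ) + 2)) atTop atTop :=
    tendsto_atTop_mono (fun p => by
      have : (0 : ℝ) ≤ p.1 := p.1.cast_nonneg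
      rw [Function.comp_apply]
      linarith) (tendsto_natCast_atTop_atTop.comp t1)
  have hπ : π / 2 ≠ 0 := by positivity
  have h := ((hW.comp t3).div (((hW.comp t1).pow 2).mul (hW.comp t2)) (by positivity)).mul
    ((tendsto_const_nhds (x := (1 : ℝ)).div_atTop t4).const_sub 1)
  have e : π / 2 / ((π / 2) ^ 2 * (π / 2)) * (1 - 0) = 4 / π ^ 2 := by
    field_simp
    norm_num
  rw [e] at h
  exact h

lemma wallisWeight_mem_Icc (k m : ℕ) : wallisWeight k m ∈ Set.Icc 0 (π / 2) := by
  have h1 := one_le_wallis k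
  have h2 := one_le_wallis m
  have h3 := Wallis.W_pos (2 * k + m)
  have h4 : 1 / (4 * k + 2 : ℝ) ≤ 1 := by
    rw [div_le_one (by positivity)]
    linarith [(k.cast_nonneg : (0 : ℝ) ≤ k)]
  have h5 : 0 ≤ 1 / (4 * k + 2 : ℝ) := by positivity
  have h6 : 1 ≤ Wallis.W k ^ 2 * Wallis.W m :=
    one_le_mul_of_one_le_of_one_le (one_le_pow₀ h1) h2
  refine ⟨mul_nonneg (by positivity) (by linarith), ?_⟩
  calc wallisWeight k m ≤ Wallis.W (2 * k + m) / (Wallis.W k ^ 2 * Wallis.W m) :=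
        mul_le_of_le_one_right (by positivity) (by linarith)
    _ ≤ Wallis.W (2 * k + m) := div_le_self h3.le h6
    _ ≤ π / 2 := Wallis.W_le _

end Asymptotics

/-- there is a constant `c > 0` with
`(ℓ²/log ℓ) ∫₀^π P_ℓ(cos θ)⁴ sin θ dθ → c`, i.e. the fourth-moment integral of
Legendre polynomials is of order `(log ℓ)/ℓ²`. -/
theorem fourth_moment_legendre_log_asymptotics :
    ∃ c > (0 : ℝ),
      Tendsto (fun ℓ : ℕ =>
          ((ℓ : ℝ) ^ 2 / Real.log ℓ) *
            ∫ θ in (0 : ℝ)..π, (legendreP ℓ (Real.cos θ)) ^ 4 * Real.sin θ)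
        atTop (nhds c) := by
  refine ⟨4 / π ^ 2 * (3 / 4), by positivity, ?_⟩
  have hmain := tendsto_weighted_antidiagonal_sum (ω := wallisWeight)
    (h := fun k m => 4 / ((2 * k + 1 : ℝ) * (2 * m + 1) * (2 * (2 * k + m) + 1)))
    (r := fun n => (n : ℝ) ^ 2 / Real.log n) (s := fun n => 4 / (n + 1 : ℝ) ^ 2)
    (B := π / 2 + 4 / π ^ 2) tendsto_wallisWeight ?_ (fun k m => by positivity)
    (fun n => div_nonneg (by positivity) (Real.log_natCast_nonneg n)) ?_ ?_
    tendsto_sum_antidiagonal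
  · refine hmain.congr fun n => ?_
    rw [integral_legendreP_pow_four]
    congr 1
    refine Finset.sum_congr rfl fun k hk => ?_
    obtain ⟨m, rfl⟩ := Nat.exists_eq_add_of_le (show k ≤ n by simp at hk; omega)
    rw [Nat.add_sub_cancel_left, wallisWeight, show k + m + k = 2 * k + m by ring]
    have h1 := (Wallis.W_pos k).ne'
    have h2 := (Wallis.W_pos m).ne'
    push_cast
    have e1 : (2 * (k + m) - 2 * k + 1 : ℝ) = 2 * m + 1 := by ring
    have e2 : (2 * (k + m) + 2 * k + 1 : ℝ) = 2 * (2 * k + m) + 1 := by ring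
    have e3 : (1 - 1 / (4 * k + 2) : ℝ) = (4 * k + 1) / (2 * (2 * k + 1)) := by
      field_simp
      ring
    rw [e1, e2, e3]
    field_simp
  · intro k m
    have h := wallisWeight_mem_Icc k m
    have hp : 0 < 4 / π ^ 2 := by positivity
    have := h.1
    have := h.2
    rw [abs_le]
    constructor <;> linarith [Real.pi_pos]
  · intro k m
    have hk : (0 : ℝ) ≤ k := k.cast_nonneg
    have hm : (0 : ℝ) ≤ m := m.cast_nonneg
    push_cast
    refine div_le_div_of_nonneg_left (by norm_num) (by positivity) ?_
    rw [sq]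
    refine mul_le_mul ?_ (by linarith) (by positivity) (by positivity)
    nlinarith [mul_nonneg hk hm]
  · refine squeeze_zero (fun n => mul_nonneg (div_nonneg (by positivity)
      (Real.log_natCast_nonneg n)) (by positivity)) (fun n => ?_)
      (tendsto_const_nhds (x := (4 : ℝ)).div_atTop tendsto_natCast_log_atTop)
    calc (n : ℝ) ^ 2 / Real.log n * (4 / (n + 1 : ℝ) ^ 2)
        = (n : ℝ) ^ 2 / (n + 1 : ℝ) ^ 2 * (4 / Real.log n) := by ring
      _ ≤ 4 / Real.log n := by
        refine mul_le_of_le_one_left (div_nonneg (by norm_num) (Real.log_natCast_nonneg n)) ?_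
        rw [div_le_one (by positivity)]
        gcongr
        linarith
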